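/- arXiv:2012.02293 — 3 statements merged into one kernel-verified Lean document; each statement's English description precedes it below -/
import Mathlib

section
/- Let μ ∈ ℝ^d, let g : ℝ^d → [0,∞) be a probability density that is symmetric about μ (i.e. g(μ + w) = g(μ − w) for all w ∈ ℝ^d), and let φ : ℝ^d → [0,1] be a measurable penalty function satisfying the symmetry condition φ(μ − w) = 1 − φ(μ + w) for all w ∈ ℝ^d. Then ∫_{ℝ^d} g(w) φ(w) dw = 1/2. -/
open MeasureTheory

/-- Proposition 1 of the paper: if `g` is a probability density on `ℝ^d` symmetric about `μ`
and `φ : ℝ^d → [0,1]` is a measurable penalty satisfying `φ (μ - w) = 1 - φ (μ + w)`,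
then `∫ g φ = 1/2`. -/
theorem penalised_proposal_normalising_constant
    {d : ℕ} (μ : Fin d → ℝ) (g φ : (Fin d → ℝ) → ℝ)
    (hg_meas : Measurable g) (hg_nonneg : ∀ w, 0 ≤ g w)
    (hg_int : ∫ w : Fin d → ℝ, g w = 1)
    (hg_symm : ∀ w : Fin d → ℝ, g (μ + w) = g (μ - w))
    (hφ_meas : Measurable φ)
    (hφ_range : ∀ w, φ w ∈ Set.Icc (0 : ℝ) 1)
    (hφ_symm : ∀ w : Fin d → ℝ, φ (μ - w) = 1 - φ (μ + w)) :
    ∫ w : Fin d → ℝ, g w * φ w = 1 / 2 := by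
  have hg : Integrable g := .of_integral_ne_zero (by simp [hg_int])
  have hgφ : Integrable fun w => g w * φ w :=
    hg.mul_bdd (c := 1) hφ_meas.aestronglyMeasurable <| .of_forall fun w => by
      rw [Real.norm_of_nonneg (hφ_range w).1]
      exact (hφ_range w).2
  have hreflect : ∀ w, g (μ + μ - w) * φ (μ + μ - w) = g w - g w * φ w := fun w => by
    have hsub : μ + μ - w = μ - (w - μ) := by abel
    rw [hsub, ← hg_symm, hφ_symm, add_sub_cancel]
    ring
  have hsum : ∫ w, g w * φ w = 1 - ∫ w, g w * φ w := by
    rw [← hg_int, ← integral_sub hg hgφ]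
    simp only [← hreflect]
    exact (integral_sub_left_eq_self (fun w => g w * φ w) volume (μ + μ)).symm
  linarith
end

section
/- Let μ ∈ ℝ^d, let g : ℝ^d → [0,∞) be a probability density symmetric about μ, and let φ : ℝ^d → [0,1] be measurable with φ(μ − w) = 1 − φ(μ + w) for all w. Then for every bounded measurable f : ℝ^d → ℝ, ∫_{ℝ^d} g(w) [ φ(w) f(w) + (1 − φ(w)) f(2μ − w) ] dw = ∫_{ℝ^d} 2 g(w) φ(w) f(w) dw. Consequently, the sampler that draws W from density g and Ω uniform on (0,1), and returns W if Ω ≤ φ(W) and 2μ − W otherwise, produces a draw from the density w ↦ 2 g(w) φ(w). -/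
open MeasureTheory

theorem lintegral_Ioo_zero_one_ite_le {a : ℝ} (ha : a ∈ Set.Icc (0 : ℝ) 1) (x y : ENNReal) :
    ∫⁻ v in Set.Ioo (0 : ℝ) 1, (if v ≤ a then x else y)
      = ENNReal.ofReal a * x + ENNReal.ofReal (1 - a) * y := by
  have hsplit : (fun v : ℝ => if v ≤ a then x else y)
      = fun v => (Set.Iic a).indicator (fun _ => x) v + (Set.Ioi a).indicator (fun _ => y) v := by
    ext v
    by_cases h : v ≤ a
    · simp [h]
    · simp [h, not_le.mp h]
  have hleft : Set.Iic a ∩ Set.Ioc 0 1 = Set.Ioc 0 a := by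
    ext v
    simp only [Set.mem_inter_iff, Set.mem_Iic, Set.mem_Ioc]
    exact ⟨fun h => ⟨h.2.1, h.1⟩, fun h => ⟨h.2, h.1, h.2.trans ha.2⟩⟩
  have hright : Set.Ioi a ∩ Set.Ioc 0 1 = Set.Ioc a 1 := by
    ext v
    simp only [Set.mem_inter_iff, Set.mem_Ioi, Set.mem_Ioc]
    exact ⟨fun h => ⟨h.1, h.2.2⟩, fun h => ⟨h.1, ha.1.trans_lt h.1, h.2⟩⟩
  rw [Measure.restrict_congr_set (Ioo_ae_eq_Ioc (μ := volume)), hsplit,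
    lintegral_add_left (measurable_const.indicator measurableSet_Iic),
    lintegral_indicator_const measurableSet_Iic, lintegral_indicator_const measurableSet_Ioi,
    Measure.restrict_apply measurableSet_Iic, Measure.restrict_apply measurableSet_Ioi,
    hleft, hright, Real.volume_Ioc, Real.volume_Ioc, sub_zero, mul_comm x, mul_comm y]

/-- Correctness of the flip sampler (Algorithm 1): for every bounded measurable `f`,
`∫ g(w) [φ(w) f(w) + (1-φ(w)) f(2μ-w)] dw = ∫ 2 g(w) φ(w) f(w) dw`; consequently, drawing
`W ∼ g` and `V ∼ Unif(0,1)` and returning `W` if `V ≤ φ(W)` and `2μ - W` otherwise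
produces a draw from the density `w ↦ 2 g(w) φ(w)`. -/
theorem flip_sampler_correct
    {d : ℕ} (μ : Fin d → ℝ) (g φ : (Fin d → ℝ) → ℝ)
    (hg_meas : Measurable g) (hg_nonneg : ∀ w, 0 ≤ g w)
    (hg_int : ∫ w : Fin d → ℝ, g w = 1)
    (hg_symm : ∀ w : Fin d → ℝ, g (μ + w) = g (μ - w))
    (hφ_meas : Measurable φ)
    (hφ_range : ∀ w, φ w ∈ Set.Icc (0 : ℝ) 1)
    (hφ_symm : ∀ w : Fin d → ℝ, φ (μ - w) = 1 - φ (μ + w))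
    {Ω : Type*} [MeasurableSpace Ω] (P : Measure Ω) [IsProbabilityMeasure P]
    (W : Ω → (Fin d → ℝ)) (V : Ω → ℝ) (hW : Measurable W) (hV : Measurable V)
    (hWlaw : Measure.map W P = volume.withDensity (fun w => ENNReal.ofReal (g w)))
    (hVlaw : Measure.map V P = volume.restrict (Set.Ioo (0 : ℝ) 1))
    (hind : ProbabilityTheory.IndepFun W V P) :
    (∀ f : (Fin d → ℝ) → ℝ, Measurable f → (∃ C, ∀ w, |f w| ≤ C) →
      ∫ w : Fin d → ℝ, g w * (φ w * f w + (1 - φ w) * f ((2 : ℝ) • μ - w))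
        = ∫ w : Fin d → ℝ, 2 * g w * φ w * f w) ∧
    Measure.map (fun ω => if V ω ≤ φ (W ω) then W ω else (2 : ℝ) • μ - W ω) P
      = volume.withDensity (fun w => ENNReal.ofReal (2 * g w * φ w)) := by
  have hg_flip : ∀ w, g ((2 : ℝ) • μ - w) = g w := by
    intro w
    have h := hg_symm (w - μ)
    rw [add_sub_cancel, sub_sub_eq_add_sub, ← two_smul ℝ μ] at h
    exact h.symm
  have hφ_flip : ∀ w, φ ((2 : ℝ) • μ - w) = 1 - φ w := by
    intro w
    have h := hφ_symm (w - μ)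
    rwa [add_sub_cancel, sub_sub_eq_add_sub, ← two_smul ℝ μ] at h
  constructor
  · rintro f hf ⟨C, hC⟩
    have hg : Integrable g := by
      by_contra h
      simp [integral_undef h] at hg_int
    have h_integrable : Integrable (fun w => g w * (φ w * f w)) := by
      refine hg.mul_bdd (c := C) (hφ_meas.mul hf).aestronglyMeasurable (ae_of_all _ fun w => ?_)
      rw [Real.norm_eq_abs, abs_mul, abs_of_nonneg (hφ_range w).1]
      exact (mul_le_of_le_one_left (abs_nonneg _) (hφ_range w).2).trans (hC w)
    have hflip : (fun w => g w * ((1 - φ w) * f ((2 : ℝ) • μ - w)))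
        = fun w => (fun u => g u * (φ u * f u)) ((2 : ℝ) • μ - w) := by
      ext w
      simp only [hg_flip, hφ_flip]
    have h_integrable' : Integrable (fun w => g w * ((1 - φ w) * f ((2 : ℝ) • μ - w))) := by
      rw [hflip]
      exact h_integrable.comp_sub_left _
    simp only [mul_add]
    rw [integral_add h_integrable h_integrable', hflip,
      integral_sub_left_eq_self (fun u => g u * (φ u * f u)) volume, ← integral_add h_integrable h_integrable]
    congr 1 with w
    ring
  · have hlaw : Measure.map (fun ω => (W ω, V ω)) P
        = (volume.withDensity fun w => ENNReal.ofReal (g w)).prod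
          (volume.restrict (Set.Ioo (0 : ℝ) 1)) := by
      rw [← hWlaw, ← hVlaw]
      exact (ProbabilityTheory.indepFun_iff_map_prod_eq_prod_map_map hW.aemeasurable
        hV.aemeasurable).mp hind
    have hT : Measurable (fun p : (Fin d → ℝ) × ℝ =>
        if p.2 ≤ φ p.1 then p.1 else (2 : ℝ) • μ - p.1) :=
      Measurable.ite (measurableSet_le measurable_snd (hφ_meas.comp measurable_fst))
        measurable_fst (measurable_const.sub measurable_fst)
    have hcomp : Measure.map (fun ω => if V ω ≤ φ (W ω) then W ω else (2 : ℝ) • μ - W ω) P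
        = Measure.map (fun p : (Fin d → ℝ) × ℝ =>
            if p.2 ≤ φ p.1 then p.1 else (2 : ℝ) • μ - p.1)
          (Measure.map (fun ω => (W ω, V ω)) P) :=
      (Measure.map_map hT (hW.prodMk hV)).symm
    have hGm : Measurable fun w => ENNReal.ofReal (g w) := hg_meas.ennreal_ofReal
    have hΦm : Measurable fun w => ENNReal.ofReal (φ w) := hφ_meas.ennreal_ofReal
    refine Measure.ext_of_lintegral _ fun F hF => ?_
    have hmeas : Measurable fun w => ENNReal.ofReal (g w) * (ENNReal.ofReal (φ w) * F w) :=
      hGm.mul (hΦm.mul hF)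
    have hflip : (fun w => ENNReal.ofReal (g w) *
          (ENNReal.ofReal (1 - φ w) * F ((2 : ℝ) • μ - w)))
        = fun w => (fun u => ENNReal.ofReal (g u) * (ENNReal.ofReal (φ u) * F u))
          ((2 : ℝ) • μ - w) := by
      ext w
      simp only [hg_flip, hφ_flip]
    have hinner : ∀ w, ∫⁻ v in Set.Ioo (0 : ℝ) 1, F (if v ≤ φ w then w else (2 : ℝ) • μ - w)
        = ENNReal.ofReal (φ w) * F w + ENNReal.ofReal (1 - φ w) * F ((2 : ℝ) • μ - w) := by
      intro w
      simp only [apply_ite F]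
      exact lintegral_Ioo_zero_one_ite_le (hφ_range w) _ _
    have hinner_meas : Measurable fun w =>
        ENNReal.ofReal (φ w) * F w + ENNReal.ofReal (1 - φ w) * F ((2 : ℝ) • μ - w) := by
      fun_prop
    rw [hcomp, hlaw, lintegral_map hF hT,
      lintegral_prod (fun p : (Fin d → ℝ) × ℝ => F (if p.2 ≤ φ p.1 then p.1 else (2 : ℝ) • μ - p.1))
        (hF.comp hT).aemeasurable]
    simp only [hinner]
    rw [lintegral_withDensity_eq_lintegral_mul _ hGm hinner_meas,
      lintegral_withDensity_eq_lintegral_mul _ (by fun_prop) hF]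
    simp only [Pi.mul_apply, mul_add]
    rw [lintegral_add_left hmeas, hflip,
      lintegral_sub_left_eq_self (fun u => ENNReal.ofReal (g u) * (ENNReal.ofReal (φ u) * F u)),
      ← lintegral_add_left hmeas]
    congr 1 with w
    rw [ENNReal.ofReal_mul (mul_nonneg zero_le_two (hg_nonneg w)),
      ENNReal.ofReal_mul zero_le_two, ENNReal.ofReal_ofNat]
    ring
end

section
/- Let 𝒳₁ ⊆ ℝ^d be measurable and π̃ : ℝ^d → (0,∞) strictly positive on 𝒳₁ with Z₁ = ∫_{𝒳₁} π̃ ∈ (0,∞), and let π₁ = π̃ 𝟙_{𝒳₁}/Z₁. On a probability space let X (valued in a measurable space E) and Y (valued in ℝ^d) be independent random variables with Y having density π₁. Let k : E × ℝ^d → [0,∞) be measurable such that for every x ∈ E, k(x, ·) is a probability density supported on 𝒳₁ (k(x,y) = 0 for y ∉ 𝒳₁ and ∫_{𝒳₁} k(x,y) dy = 1). Then E[ k(X, Y)/π̃(Y) ] = Z₁^{−1}. -/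
open MeasureTheory ProbabilityTheory

/-- If `f` is nonnegative with integral one over `s`, then the importance ratio `f / g` integrates
to `c⁻¹` against the measure with density `g 1_s / c`. -/
theorem lintegral_div_withDensity_indicator {α : Type*} [MeasurableSpace α] {μ : Measure α}
    {s : Set α} (hs : MeasurableSet s) {f g : α → ℝ} {c : ℝ} (hc : 0 < c)
    (hf : Measurable f) (hg : Measurable g) (hf_nonneg : ∀ y, 0 ≤ f y)
    (hg_pos : ∀ y ∈ s, 0 < g y) (hf_int : ∫ y in s, f y ∂μ = 1) :
    ∫⁻ y, ENNReal.ofReal (f y / g y)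
        ∂(μ.withDensity fun y => ENNReal.ofReal (s.indicator g y / c))
      = ENNReal.ofReal c⁻¹ := by
  have hf_integrable : Integrable f (μ.restrict s) :=
    Integrable.of_integral_ne_zero (by rw [hf_int]; exact one_ne_zero)
  rw [lintegral_withDensity_eq_lintegral_mul _
    ((hg.indicator hs).div_const c).ennreal_ofReal
    (g := fun y => ENNReal.ofReal (f y / g y)) (hf.div hg).ennreal_ofReal]
  calc
    _ = ∫⁻ y, s.indicator (fun y => ENNReal.ofReal c⁻¹ * ENNReal.ofReal (f y)) y ∂μ := by
      refine lintegral_congr fun y => ?_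
      by_cases hy : y ∈ s
      · have hgy := hg_pos y hy
        simp only [Pi.mul_apply, Set.indicator_of_mem hy]
        rw [← ENNReal.ofReal_mul (by positivity), ← ENNReal.ofReal_mul (by positivity)]
        congr 1
        field_simp
      · simp [hy]
    _ = ENNReal.ofReal c⁻¹ := by
      rw [lintegral_indicator hs, lintegral_const_mul _ hf.ennreal_ofReal,
        ← ofReal_integral_eq_lintegral_ofReal hf_integrable (ae_of_all _ hf_nonneg), hf_int]
      simp

/-- Unbiasedness of the leave-one-out KDE estimator of `Z₁⁻¹` (equation (10) of the paper):
if `X ⟂ Y`, `Y` has density `π₁ = π̃ 𝟙_{𝒳₁}/Z₁`, and `k(x,·)` is a probability density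
supported on `𝒳₁` for every `x`, then `E[k(X,Y)/π̃(Y)] = Z₁⁻¹`. -/
theorem kde_estimator_unbiased
    {d : ℕ} {E : Type*} [MeasurableSpace E] {Ω : Type*} [MeasurableSpace Ω]
    (P : Measure Ω) [IsProbabilityMeasure P]
    (X1 : Set (Fin d → ℝ)) (hX1 : MeasurableSet X1)
    (pit : (Fin d → ℝ) → ℝ) (hpit_meas : Measurable pit)
    (hpit_pos : ∀ x ∈ X1, 0 < pit x)
    (Z1 : ℝ) (hZ1 : Z1 = ∫ x in X1, pit x) (hZ1_pos : 0 < Z1)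
    (X : Ω → E) (Y : Ω → (Fin d → ℝ)) (hX : Measurable X) (hY : Measurable Y)
    (hindep : IndepFun X Y P)
    (hYlaw : Measure.map Y P
      = volume.withDensity (fun y => ENNReal.ofReal (Set.indicator X1 pit y / Z1)))
    (k : E → (Fin d → ℝ) → ℝ) (hk_meas : Measurable (Function.uncurry k))
    (hk_nonneg : ∀ x y, 0 ≤ k x y)
    (hk_supp : ∀ x, ∀ y ∉ X1, k x y = 0)
    (hk_int : ∀ x, ∫ y in X1, k x y = 1) :
    ∫ ω, k (X ω) (Y ω) / pit (Y ω) ∂P = Z1⁻¹ := by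
  have hratio_meas : Measurable fun p : E × (Fin d → ℝ) => k p.1 p.2 / pit p.2 :=
    hk_meas.div (hpit_meas.comp measurable_snd)
  have hratio_nonneg : ∀ x y, 0 ≤ k x y / pit y := fun x y => by
    by_cases hy : y ∈ X1
    · exact div_nonneg (hk_nonneg x y) (hpit_pos y hy).le
    · simp [hk_supp x y hy]
  have := Measure.isProbabilityMeasure_map (μ := P) hX.aemeasurable
  have := Measure.isProbabilityMeasure_map (μ := P) hY.aemeasurable
  have hlintegral :
      ∫⁻ ω, ENNReal.ofReal (k (X ω) (Y ω) / pit (Y ω)) ∂P = ENNReal.ofReal Z1⁻¹ := by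
    rw [← lintegral_map (f := fun p : E × (Fin d → ℝ) => ENNReal.ofReal (k p.1 p.2 / pit p.2))
        hratio_meas.ennreal_ofReal (hX.prodMk hY),
      (indepFun_iff_map_prod_eq_prod_map_map hX.aemeasurable hY.aemeasurable).1 hindep,
      lintegral_prod _ hratio_meas.ennreal_ofReal.aemeasurable, hYlaw]
    refine (lintegral_congr fun x => lintegral_div_withDensity_indicator hX1 hZ1_pos
      (hk_meas.comp measurable_prodMk_left : Measurable (k x)) hpit_meas (hk_nonneg x) hpit_pos
      (hk_int x)).trans ?_
    simp
  rw [integral_eq_lintegral_of_nonneg_ae (ae_of_all _ fun ω => hratio_nonneg _ _)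
      (hratio_meas.comp (hX.prodMk hY)).aestronglyMeasurable,
    hlintegral, ENNReal.toReal_ofReal (by positivity)]
end
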